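/- If the depolarizing channel D_η(ρ) = (1−η)ρ + η·tr(ρ)·1/d_{A_I} with η = d_{A_I}/(d_{A_I}+1) is entanglement breaking, then for any bipartite ordered process W the mixture with white noise at ratio r = 1 − 1/(d_{A_I}d_{A_O}d_{B_I}+1) is classical CCDC: (1−r)W + r·1/(d_{A_I}d_{B_I}) decomposes as a convex combination of direct-cause processes; hence R_WN(W) ≤ 1 − 1/(d_{A_I}d_{A_O}d_{B_I}+1). -/

import Mathlib

open Matrix ComplexOrder

/-- Direct-cause processes: `W = Σ_k w_k ρ_k^{A_I} ⊗ D_k^{A_O B_I}` with `ρ_k` states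
and `D_k` Choi operators of channels from `A_O` to `B_I`. -/
def IsDC (nI nO nB : ℕ)
    (W : Matrix (Fin nI × Fin nO × Fin nB) (Fin nI × Fin nO × Fin nB) ℂ) : Prop :=
  ∃ (m : ℕ) (w : Fin m → ℝ) (ρs : Fin m → Matrix (Fin nI) (Fin nI) ℂ)
    (Ds : Fin m → Matrix (Fin nO × Fin nB) (Fin nO × Fin nB) ℂ),
    (∀ k, 0 ≤ w k) ∧ (∑ k, w k) = 1 ∧
    (∀ k, (ρs k).PosSemidef) ∧ (∀ k, (ρs k).trace = 1) ∧
    (∀ k, (Ds k).PosSemidef) ∧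
    (∀ k a a', (∑ b : Fin nB, Ds k (a, b) (a', b)) = if a = a' then 1 else 0) ∧
    W = ∑ k, (w k : ℂ) • Matrix.of fun p q : Fin nI × Fin nO × Fin nB =>
      ρs k p.1 q.1 * Ds k p.2 q.2

/-- Common-cause processes: `W = ρ^{A_I B_I} ⊗ 1^{A_O}` with `ρ` a state. -/
def IsCC (nI nO nB : ℕ)
    (W : Matrix (Fin nI × Fin nO × Fin nB) (Fin nI × Fin nO × Fin nB) ℂ) : Prop :=
  ∃ ρ : Matrix (Fin nI × Fin nB) (Fin nI × Fin nB) ℂ, ρ.PosSemidef ∧ ρ.trace = 1 ∧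
    W = Matrix.of fun p q : Fin nI × Fin nO × Fin nB =>
      ρ (p.1, p.2.2) (q.1, q.2.2) * (if p.2.1 = q.2.1 then 1 else 0)

/-- Classical CCDC processes: convex mixtures of a common-cause and a direct-cause
process. -/
def IsCCDC (nI nO nB : ℕ)
    (W : Matrix (Fin nI × Fin nO × Fin nB) (Fin nI × Fin nO × Fin nB) ℂ) : Prop :=
  ∃ (p : ℝ) (Wcc Wdc : Matrix (Fin nI × Fin nO × Fin nB) (Fin nI × Fin nO × Fin nB) ℂ),
    0 ≤ p ∧ p ≤ 1 ∧ IsCC nI nO nB Wcc ∧ IsDC nI nO nB Wdc ∧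
    W = (p : ℂ) • Wcc + ((1 - p : ℝ) : ℂ) • Wdc

/-- Bipartite ordered processes: `W ⪰ 0` and `tr_{B_I}(W) = σ ⊗ 1^{A_O}` for some
state `σ`. -/
def IsOrdered (nI nO nB : ℕ)
    (W : Matrix (Fin nI × Fin nO × Fin nB) (Fin nI × Fin nO × Fin nB) ℂ) : Prop :=
  W.PosSemidef ∧ ∃ σ : Matrix (Fin nI) (Fin nI) ℂ, σ.PosSemidef ∧ σ.trace = 1 ∧
    ∀ i a j a', (∑ b : Fin nB, W (i, a, b) (j, a', b))
      = σ i j * (if a = a' then 1 else 0)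

/-- Spectral expansion of a positive semidefinite matrix. -/
theorem Matrix.PosSemidef.exists_spectral_expansion {n : Type*} [Fintype n] [DecidableEq n]
    {X : Matrix n n ℂ} (hX : X.PosSemidef) :
    ∃ C : Matrix n n ℂ, ∀ i j, X i j = ∑ k, C i k * star (C j k) := by
  set U : Matrix n n ℂ := (hX.1.eigenvectorUnitary : Matrix n n ℂ)
  refine ⟨U * diagonal fun k => ((√(hX.1.eigenvalues k) : ℝ) : ℂ), fun i j => ?_⟩
  conv_lhs => rw [hX.1.spectral_theorem]
  rw [Unitary.conjStarAlgAut_apply, mul_apply]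
  refine Finset.sum_congr rfl fun k _ => ?_
  have h : ((√(hX.1.eigenvalues k) : ℝ) : ℂ) * ((√(hX.1.eigenvalues k) : ℝ) : ℂ)
      = (hX.1.eigenvalues k : ℂ) := by
    rw [← Complex.ofReal_mul, Real.mul_self_sqrt (hX.eigenvalues_nonneg k)]
  simp only [mul_diagonal, Function.comp_apply, star_mul', Complex.star_def, Complex.conj_ofReal,
    star_apply, Complex.coe_algebraMap]
  change U i k * _ * star (U j k) = _
  simp only [Complex.star_def]
  linear_combination -(U i k * (starRingEnd ℂ) (U j k)) * h

/-- A positive semidefinite matrix is bounded above by its trace. -/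
theorem Matrix.PosSemidef.trace_smul_one_sub {n : Type*} [Fintype n] [DecidableEq n]
    {X : Matrix n n ℂ} (hX : X.PosSemidef) : (X.trace • (1 : Matrix n n ℂ) - X).PosSemidef := by
  set U : Matrix n n ℂ := (hX.1.eigenvectorUnitary : Matrix n n ℂ)
  have hU : U * Uᴴ = 1 := Unitary.coe_mul_star_self hX.1.eigenvectorUnitary
  have hd : (diagonal fun k => ((∑ l, hX.1.eigenvalues l - hX.1.eigenvalues k : ℝ) : ℂ) :
      Matrix n n ℂ).PosSemidef := by
    refine PosSemidef.diagonal fun k => ?_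
    have := Finset.single_le_sum (fun l _ => hX.eigenvalues_nonneg l) (Finset.mem_univ k)
    simpa using Complex.zero_le_real.mpr (sub_nonneg.mpr this)
  convert hd.mul_mul_conjTranspose_same U using 1
  have h1 : (diagonal fun k => ((∑ l, hX.1.eigenvalues l - hX.1.eigenvalues k : ℝ) : ℂ) :
      Matrix n n ℂ) = X.trace • 1 - diagonal (RCLike.ofReal ∘ hX.1.eigenvalues) := by
    ext i j
    by_cases h : i = j <;> simp [h, hX.1.trace_eq_sum_eigenvalues]
  have h2 := hX.1.spectral_theorem
  rw [Unitary.conjStarAlgAut_apply] at h2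
  rw [h1, Matrix.mul_sub, Matrix.sub_mul, Matrix.mul_smul, Matrix.mul_one, Matrix.smul_mul, hU]
  congr 1

/-- Contracting one tensor factor of a positive semidefinite matrix with a positive semidefinite
matrix gives a positive semidefinite matrix. -/
theorem Matrix.PosSemidef.contract_left {m n : Type*} [Fintype m] [DecidableEq m] [Fintype n]
    [DecidableEq n] {B : Matrix m m ℂ} {W : Matrix (m × n) (m × n) ℂ}
    (hB : B.PosSemidef) (hW : W.PosSemidef) :
    (Matrix.of fun x y => ∑ a, ∑ b, B a b * W (a, x) (b, y) : Matrix n n ℂ).PosSemidef := by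
  obtain ⟨C, hC⟩ := hB.exists_spectral_expansion
  let V : m → Matrix (m × n) n ℂ :=
    fun k => Matrix.of fun p y => star (C p.1 k) * if p.2 = y then 1 else 0
  convert posSemidef_sum Finset.univ
    (fun k _ => hW.conjTranspose_mul_mul_same (V k)) using 1
  ext x y
  simp only [of_apply, hC, Matrix.sum_apply, mul_apply, V, conjTranspose_apply, Fintype.sum_prod_type,
    star_star, apply_ite star, star_zero, mul_ite, ite_mul, mul_one, mul_zero,
    zero_mul, Finset.sum_ite_eq', Finset.mem_univ, if_true, Finset.sum_mul]
  rw [Finset.sum_comm]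
  conv_rhs => rw [Finset.sum_comm]
  refine Finset.sum_congr rfl fun b _ => ?_
  rw [Finset.sum_comm]
  exact Finset.sum_congr rfl fun k _ => Finset.sum_congr rfl fun a _ => by ring

/-- Inverse natural multiples of the identity are positive semidefinite. -/
theorem posSemidef_inv_smul_one {n : Type*} [Fintype n] [DecidableEq n] (d : ℕ) :
    (((d : ℂ)⁻¹) • (1 : Matrix n n ℂ)).PosSemidef :=
  PosSemidef.one.smul (by
    rw [← Complex.ofReal_natCast, ← Complex.ofReal_inv]
    exact Complex.zero_le_real.mpr (by positivity))

/-- A product of positive operators whose second factor is proportional to a Choi operator of a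
channel is a nonnegative multiple of a product of a state and such a Choi operator. -/
theorem exists_state_channel_of_posSemidef {nI nO nB : ℕ} (hI : 1 ≤ nI) (hB : 1 ≤ nB)
    {A : Matrix (Fin nI) (Fin nI) ℂ} {F : Matrix (Fin nO × Fin nB) (Fin nO × Fin nB) ℂ} {c : ℂ}
    (hA : A.PosSemidef) (hF : F.PosSemidef) (hc : 0 ≤ c)
    (hFc : ∀ a a', (∑ b, F (a, b) (a', b)) = if a = a' then c else 0) :
    ∃ (w : ℝ) (R : Matrix (Fin nI) (Fin nI) ℂ)
      (D : Matrix (Fin nO × Fin nB) (Fin nO × Fin nB) ℂ),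
      0 ≤ w ∧ R.PosSemidef ∧ R.trace = 1 ∧ D.PosSemidef ∧
      (∀ a a', (∑ b, D (a, b) (a', b)) = if a = a' then 1 else 0) ∧
      ∀ i j x y, A i j * F x y = (w : ℂ) * (R i j * D x y) := by
  have hI' : (nI : ℂ) ≠ 0 := by exact_mod_cast (by omega : nI ≠ 0)
  have hB' : (nB : ℂ) ≠ 0 := by exact_mod_cast (by omega : nB ≠ 0)
  by_cases h : A.trace = 0 ∨ c = 0
  · refine ⟨0, (nI : ℂ)⁻¹ • 1, (nB : ℂ)⁻¹ • 1, le_rfl, posSemidef_inv_smul_one _, ?_,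
      posSemidef_inv_smul_one _, fun a a' => ?_, fun i j x y => ?_⟩
    · simp [trace_smul, hI']
    · by_cases haa : a = a' <;> simp [one_apply, haa, hB']
    · rcases h with h | h
      · simp [hA.trace_eq_zero_iff.mp h]
      · have : F.trace = 0 := by
          simp only [Matrix.trace, diag_apply, Fintype.sum_prod_type, hFc, h]
          simp
        simp [hF.trace_eq_zero_iff.mp this]
  · push Not at h
    obtain ⟨hA0, hc0⟩ := h
    have hAt := hA.trace_nonneg
    have hw := mul_nonneg hc hAt
    refine ⟨(c * A.trace).re, A.trace⁻¹ • A, c⁻¹ • F, (Complex.nonneg_iff.mp hw).1,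
      hA.smul (inv_nonneg.mpr hAt), ?_, hF.smul (inv_nonneg.mpr hc), fun a a' => ?_,
      fun i j x y => ?_⟩
    · simp [trace_smul, hA0]
    · simp only [Matrix.smul_apply, smul_eq_mul, ← Finset.mul_sum, hFc]
      by_cases haa : a = a' <;> simp [haa, hc0]
    · rw [show (((c * A.trace).re : ℝ) : ℂ) = c * A.trace from
        (Complex.eq_re_of_ofReal_le (r := 0) (by simpa using hw)).symm]
      simp only [Matrix.smul_apply, smul_eq_mul]
      field_simp

/-- A sum of products of positive operators whose second factors are proportional to Choi
operators of channels is a direct-cause process once its trace is the output dimension. -/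
theorem isDC_of_sum {nI nO nB : ℕ} (hI : 1 ≤ nI) (hO : 1 ≤ nO) (hB : 1 ≤ nB)
    {ι : Type*} [Fintype ι] {M : Matrix (Fin nI × Fin nO × Fin nB) (Fin nI × Fin nO × Fin nB) ℂ}
    {A : ι → Matrix (Fin nI) (Fin nI) ℂ}
    {F : ι → Matrix (Fin nO × Fin nB) (Fin nO × Fin nB) ℂ} {c : ι → ℂ}
    (hA : ∀ k, (A k).PosSemidef) (hF : ∀ k, (F k).PosSemidef) (hc : ∀ k, 0 ≤ c k)
    (hFc : ∀ k a a', (∑ b, F k (a, b) (a', b)) = if a = a' then c k else 0)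
    (hM : ∀ p q, M p q = ∑ k, A k p.1 q.1 * F k p.2 q.2) (hMtr : M.trace = nO) :
    IsDC nI nO nB M := by
  have hO' : (nO : ℂ) ≠ 0 := by exact_mod_cast (by omega : nO ≠ 0)
  choose w R D hw hR hRt hD hDt h using fun k =>
    exists_state_channel_of_posSemidef hI hB (hA k) (hF k) (hc k) (hFc k)
  let e := (Fintype.equivFin ι).symm
  have hDtr : ∀ k, (D k).trace = nO := fun k => by
    simp [Matrix.trace, diag_apply, Fintype.sum_prod_type, hDt]
  have hsum : ∑ k, w k = 1 := by
    have h1 : M.trace = ∑ k, (w k : ℂ) * ((R k).trace * (D k).trace) := by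
      simp only [Matrix.trace, diag_apply, hM, h, Finset.sum_mul_sum]
      rw [Finset.sum_comm]
      refine Finset.sum_congr rfl fun k _ => ?_
      rw [Fintype.sum_prod_type]
      simp only [Finset.mul_sum]
    simp only [hRt, hDtr, one_mul, ← Finset.sum_mul] at h1
    have h2 : (∑ k, (w k : ℂ)) = 1 := mul_right_cancel₀ hO' (by rw [← h1, hMtr, one_mul])
    exact_mod_cast h2
  refine ⟨Fintype.card ι, fun k => w (e k), fun k => R (e k), fun k => D (e k), fun _ => hw _, ?_,
    fun _ => hR _, fun _ => hRt _, fun _ => hD _, fun _ => hDt _, ?_⟩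
  · rw [← hsum]
    exact e.sum_comp w
  · ext p q
    rw [hM]
    simp only [Matrix.sum_apply, Matrix.smul_apply, of_apply, smul_eq_mul, h]
    exact (e.sum_comp fun k => (w k : ℂ) * (R k p.1 q.1 * D k p.2 q.2)).symm

/-- The maximally entangled state is positive semidefinite. -/
theorem posSemidef_maximallyEntangled {d : ℕ} :
    (Matrix.of fun p q : Fin d × Fin d =>
      (d : ℂ)⁻¹ * ((if p.1 = p.2 then 1 else 0) * if q.1 = q.2 then 1 else 0)).PosSemidef := by
  have h := (posSemidef_vecMulVec_self_star
    (fun p : Fin d × Fin d => if p.1 = p.2 then (1 : ℂ) else 0)).smul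
    (show (0 : ℂ) ≤ (d : ℂ)⁻¹ by
      rw [← Complex.ofReal_natCast, ← Complex.ofReal_inv]
      exact Complex.zero_le_real.mpr (by positivity))
  convert h using 1
  ext p q
  simp [vecMulVec_apply, apply_ite star]

/-- If the depolarizing channel `D_η(ρ) = (1−η)ρ + η tr(ρ) 1/d_{A_I}` with
`η = d_{A_I}/(d_{A_I}+1)` is entanglement breaking, then for every bipartite ordered
process `W` the white-noise mixture at ratio `r = 1 − 1/(d_{A_I}d_{A_O}d_{B_I}+1)` is a
direct-cause process, and hence `R_WN(W) ≤ 1 − 1/(d_{A_I}d_{A_O}d_{B_I}+1)`. -/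
theorem stmt_19 (nI nO nB : ℕ) (hnI : 1 ≤ nI) (hnO : 1 ≤ nO) (hnB : 1 ≤ nB)
    (η : ℝ) (hη : η = (nI : ℝ) / (nI + 1))
    (hEB : ∀ (n : ℕ) (σ : Matrix (Fin nI × Fin n) (Fin nI × Fin n) ℂ),
      σ.PosSemidef → σ.trace = 1 →
      ∃ (m : ℕ) (A : Fin m → Matrix (Fin nI) (Fin nI) ℂ)
        (B : Fin m → Matrix (Fin n) (Fin n) ℂ),
        (∀ k, (A k).PosSemidef) ∧ (∀ k, (B k).PosSemidef) ∧
        (Matrix.of fun p q : Fin nI × Fin n =>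
            ((1 - η : ℝ) : ℂ) * σ p q +
              (η : ℂ) * ((nI : ℂ))⁻¹ * (if p.1 = q.1 then 1 else 0) *
                ∑ i : Fin nI, σ (i, p.2) (i, q.2))
          = ∑ k, Matrix.of fun p q : Fin nI × Fin n => A k p.1 q.1 * B k p.2 q.2)
    (W : Matrix (Fin nI × Fin nO × Fin nB) (Fin nI × Fin nO × Fin nB) ℂ)
    (hWord : IsOrdered nI nO nB W) (hWtr : W.trace = (nO : ℂ))
    (r : ℝ) (hr : r = 1 - 1 / ((nI : ℝ) * nO * nB + 1)) :
    IsDC nI nO nB (((1 - r : ℝ) : ℂ) • W +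
      (r : ℂ) • (((nI : ℂ) * nB)⁻¹ •
        (1 : Matrix (Fin nI × Fin nO × Fin nB) (Fin nI × Fin nO × Fin nB) ℂ))) ∧
    sInf {r' : ℝ | 0 ≤ r' ∧ r' ≤ 1 ∧
        IsCCDC nI nO nB (((1 - r' : ℝ) : ℂ) • W +
          (r' : ℂ) • (((nI : ℂ) * nB)⁻¹ •
            (1 : Matrix (Fin nI × Fin nO × Fin nB) (Fin nI × Fin nO × Fin nB) ℂ)))}
      ≤ 1 - 1 / ((nI : ℝ) * nO * nB + 1) := by
  have hI' : (nI : ℂ) ≠ 0 := by exact_mod_cast (by omega : nI ≠ 0)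
  have hO' : (nO : ℂ) ≠ 0 := by exact_mod_cast (by omega : nO ≠ 0)
  have hB' : (nB : ℂ) ≠ 0 := by exact_mod_cast (by omega : nB ≠ 0)
  have hI1 : (nI : ℂ) + 1 ≠ 0 := by exact_mod_cast (by omega : nI + 1 ≠ 0)
  have hN1 : (nI : ℂ) * nO * nB + 1 ≠ 0 := by
    exact_mod_cast (by positivity : nI * nO * nB + 1 ≠ 0)
  have hηc : (η : ℂ) = nI / (nI + 1) := by rw [hη]; push_cast; rfl
  have hrc : (r : ℂ) = 1 - 1 / ((nI : ℂ) * nO * nB + 1) := by rw [hr]; push_cast; rfl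
  have hr0 : 0 ≤ r := by
    rw [hr, sub_nonneg, div_le_one (by positivity)]
    exact le_add_of_nonneg_left (by positivity)
  have hr1 : r ≤ 1 := by
    rw [hr]
    exact sub_le_self _ (by positivity)
  have hs0 : (0 : ℂ) ≤ ((nI : ℂ) + 1) * nI / (nI * nO * nB + 1) := by
    have : (0 : ℝ) ≤ ((nI : ℝ) + 1) * nI / (nI * nO * nB + 1) := by positivity
    simpa using Complex.zero_le_real.mpr this
  have ht0 : (0 : ℂ) ≤ 1 / ((nI : ℂ) * nO * nB + 1) := by
    have : (0 : ℝ) ≤ 1 / ((nI : ℝ) * nO * nB + 1) := by positivity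
    simpa using Complex.zero_le_real.mpr this
  obtain ⟨hW, σ, hσ, hσt, hWσ⟩ := hWord
  obtain ⟨m, A, B, hA, hB, hAB⟩ := hEB nI _ posSemidef_maximallyEntangled (by
    simp [Matrix.trace, diag_apply, Fintype.sum_prod_type, hI'])
  have hAB' : ∀ i j a b, ∑ k, A k i j * B k a b = (((nI : ℂ) + 1) * nI)⁻¹ *
      ((if i = a then 1 else 0) * (if j = b then 1 else 0) +
        (if i = j then 1 else 0) * if a = b then 1 else 0) := fun i j a b => by
    have h := congrFun (congrFun hAB (i, a)) (j, b)
    simp only [of_apply, Matrix.sum_apply, ← Finset.mul_sum] at h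
    rw [← h]
    have h3 : (∑ x : Fin nI, (if x = a then (1 : ℂ) else 0) * if x = b then 1 else 0)
        = if a = b then 1 else 0 := by simp [eq_comm]
    rw [h3]
    push_cast
    rw [hηc]
    field_simp
    ring
  let F : Fin m → Matrix (Fin nO × Fin nB) (Fin nO × Fin nB) ℂ := fun k =>
    Matrix.of fun x y => ∑ a, ∑ b, B k a b * W (a, x) (b, y)
  let T : Matrix (Fin nO × Fin nB) (Fin nO × Fin nB) ℂ := Matrix.of fun x y => ∑ a, W (a, x) (a, y)
  have hF : ∀ k, (F k).PosSemidef := fun k => (hB k).contract_left hW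
  have hT : T.PosSemidef := by
    convert (PosSemidef.one (n := Fin nI) (R := ℂ)).contract_left hW using 1
    ext x y
    simp [T, one_apply]
  have hTtr : T.trace = nO := by
    rw [← hWtr]
    simp only [Matrix.trace, diag_apply, T, of_apply]
    rw [Finset.sum_comm, Fintype.sum_prod_type (f := fun p => W p p)]
  have hFsum : ∀ k a a', (∑ b, F k (a, b) (a', b)) =
      if a = a' then ∑ i, ∑ j, B k i j * σ i j else 0 := fun k a a' => by
    simp only [F, of_apply]
    rw [Finset.sum_comm]
    simp_rw [Finset.sum_comm (s := (Finset.univ : Finset (Fin nB))), ← Finset.mul_sum, hWσ]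
    split_ifs <;> simp
  have hTsum : ∀ a a', (∑ b, T (a, b) (a', b)) = if a = a' then 1 else 0 := fun a a' => by
    simp only [T, of_apply]
    rw [Finset.sum_comm]
    simp_rw [hWσ, ← Finset.sum_mul]
    change σ.trace * _ = _
    rw [hσt, one_mul]
  have hcnn : ∀ k, 0 ≤ ∑ i, ∑ j, B k i j * σ i j := fun k => by
    have h := hFsum k ⟨0, hnO⟩ ⟨0, hnO⟩
    rw [if_pos rfl] at h
    rw [← h]
    exact Finset.sum_nonneg fun b _ => (hF k).diag_nonneg
  have hDC : IsDC nI nO nB (((1 - r : ℝ) : ℂ) • W + (r : ℂ) • (((nI : ℂ) * nB)⁻¹ •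
      (1 : Matrix (Fin nI × Fin nO × Fin nB) (Fin nI × Fin nO × Fin nB) ℂ))) := by
    refine isDC_of_sum (ι := Option (Fin m)) hnI hnO hnB
      (A := fun k => k.elim 1 A)
      (F := fun k => k.elim ((1 / ((nI : ℂ) * nO * nB + 1)) • ((nO : ℂ) • 1 - T))
        fun k => (((nI : ℂ) + 1) * nI / (nI * nO * nB + 1)) • F k)
      (c := fun k => k.elim (1 / ((nI : ℂ) * nO * nB + 1) * ((nO : ℂ) * nB - 1))
        fun k => ((nI : ℂ) + 1) * nI / (nI * nO * nB + 1) * ∑ i, ∑ j, B k i j * σ i j)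
      ?_ ?_ ?_ ?_ ?_ ?_
    · rintro (_ | k)
      exacts [PosSemidef.one, hA k]
    · rintro (_ | k)
      · exact (hTtr ▸ hT.trace_smul_one_sub).smul ht0
      · exact (hF k).smul hs0
    · rintro (_ | k)
      · refine mul_nonneg ht0 (sub_nonneg.mpr ?_)
        exact_mod_cast Nat.mul_pos hnO hnB
      · exact mul_nonneg hs0 (hcnn k)
    · rintro (_ | k) a a'
      · simp only [Option.elim_none, Matrix.smul_apply, Matrix.sub_apply, smul_eq_mul,
          ← Finset.mul_sum,
          Finset.sum_sub_distrib, hTsum]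
        by_cases h : a = a' <;> simp [h, one_apply]
      · simp only [Option.elim_some, Matrix.smul_apply, smul_eq_mul, ← Finset.mul_sum, hFsum, mul_ite,
          mul_zero]
    · rintro ⟨i, x⟩ ⟨j, y⟩
      have h1 : ∑ k, A k i j * F k x y = (((nI : ℂ) + 1) * nI)⁻¹ *
          (W (i, x) (j, y) + (if i = j then 1 else 0) * T x y) := by
        simp only [F, of_apply, Finset.mul_sum]
        rw [Finset.sum_comm]
        simp_rw [Finset.sum_comm (s := (Finset.univ : Finset (Fin m))), ← mul_assoc,
          ← Finset.sum_mul, hAB', mul_assoc, ← Finset.mul_sum, add_mul, Finset.sum_add_distrib,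
          mul_assoc, ← Finset.mul_sum]
        simp [T]
      have h2 : ((1 : Matrix (Fin nI × Fin nO × Fin nB) (Fin nI × Fin nO × Fin nB) ℂ) (i, x) (j, y))
          = (if i = j then 1 else 0) * (1 : Matrix (Fin nO × Fin nB) (Fin nO × Fin nB) ℂ) x y := by
        by_cases hij : i = j <;> simp [one_apply, hij]
      simp only [Fintype.sum_option, Option.elim_none, Option.elim_some, Matrix.smul_apply, Matrix.add_apply,
        Matrix.sub_apply, smul_eq_mul, mul_left_comm (A _ i j), ← Finset.mul_sum, h1, h2]
      rw [one_apply (i := i)]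
      push_cast
      rw [hrc]
      field_simp
      ring
    · rw [trace_add, trace_smul, trace_smul, trace_smul, hWtr, trace_one]
      simp only [Fintype.card_prod, Fintype.card_fin, smul_eq_mul]
      push_cast
      field_simp
      ring
  refine ⟨hDC, hr ▸ csInf_le ⟨0, fun x hx => hx.1⟩ ⟨hr0, hr1, 0, _, _, le_rfl, zero_le_one,
    ⟨((nI * nB : ℕ) : ℂ)⁻¹ • 1, posSemidef_inv_smul_one _, ?_, rfl⟩, hDC, by simp⟩⟩
  rw [trace_smul, trace_one, Fintype.card_prod, Fintype.card_fin, Fintype.card_fin, smul_eq_mul]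
  push_cast
  field_simp
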